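/- Let G(t) be a smooth family of inner products on a finite-dimensional real Lie algebra 𝔤. Then (d/dt)|Ric_{G(t)}|²_{G(t)} = (1/2)⟨δ(G⁻¹ dG/dt), δ(Rc_G)⟩, where the norm |Ric_G|² and all inner products are taken with respect to G(t), Rc_G = G⁻¹Ric_G, and δ(A)(x,y) = A[x,y] − [Ax,y] − [x,Ay]. -/

import Mathlib

open Matrix

namespace RFN

variable {n : ℕ}

/-- Bracket determined by structure constants: `[e i, e j] = ∑ k, c i j k • e k`. -/
def bra (c : Fin n → Fin n → Fin n → ℝ) (x y : Fin n → ℝ) : Fin n → ℝ :=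
  fun k => ∑ i, ∑ j, x i * y j * c i j k

/-- `c` is a family of structure constants of a Lie algebra. -/
def IsLieSC (c : Fin n → Fin n → Fin n → ℝ) : Prop :=
  (∀ i j k, c i j k = - c j i k) ∧
  ∀ x y z, bra c (bra c x y) z + bra c (bra c y z) x + bra c (bra c z x) y = 0

def adIter (c : Fin n → Fin n → Fin n → ℝ) (v : ℕ → Fin n → ℝ) :
    ℕ → (Fin n → ℝ) → (Fin n → ℝ)
  | 0, x => x
  | m + 1, x => bra c (v m) (adIter c v m x)

/-- Nilpotency of the Lie algebra with structure constants `c`. -/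
def IsNilpotentSC (c : Fin n → Fin n → Fin n → ℝ) : Prop :=
  ∃ N : ℕ, ∀ v x, adIter c v N x = 0

/-- Inner product of vectors with respect to the metric matrix `G`. -/
def gdot (G : Matrix (Fin n) (Fin n) ℝ) (x y : Fin n → ℝ) : ℝ :=
  ∑ i, ∑ j, x i * G i j * y j

/-- Components of the Ricci bilinear form of the invariant metric `G`:
`Ric_G(x,y) = -(1/2) Σ G([x,e_i],[y,e_j])G^{ij} + (1/4) Σ G^{ip}G^{jq}G([e_i,e_j],x)G([e_p,e_q],y)`. -/
noncomputable def Ricm (c : Fin n → Fin n → Fin n → ℝ) (G : Matrix (Fin n) (Fin n) ℝ) :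
    Matrix (Fin n) (Fin n) ℝ :=
  Matrix.of fun a b =>
    -(1/2) * (∑ i, ∑ j, G⁻¹ i j * gdot G (c a i) (c b j))
    + (1/4) * (∑ i, ∑ j, ∑ p, ∑ q, G⁻¹ i p * G⁻¹ j q *
        (∑ k, c i j k * G k a) * (∑ l, c p q l * G l b))

/-- Scalar curvature `R_G = -(1/4)|[·,·]|²_G`. -/
noncomputable def scalR (c : Fin n → Fin n → Fin n → ℝ) (G : Matrix (Fin n) (Fin n) ℝ) : ℝ :=
  -(1/4) * (∑ i, ∑ j, ∑ p, ∑ q, G⁻¹ i p * G⁻¹ j q * gdot G (c i j) (c p q))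

/-- Ricci endomorphism `Rc_G = G⁻¹ Ric_G`. -/
noncomputable def Rc (c : Fin n → Fin n → Fin n → ℝ) (G : Matrix (Fin n) (Fin n) ℝ) :
    Matrix (Fin n) (Fin n) ℝ := G⁻¹ * Ricm c G

/-- `δ(A)(e_i,e_j) = A[e_i,e_j] - [A e_i, e_j] - [e_i, A e_j]` (components). -/
def deltaE (c : Fin n → Fin n → Fin n → ℝ) (A : Matrix (Fin n) (Fin n) ℝ) :
    Fin n → Fin n → Fin n → ℝ :=
  fun i j k => (∑ l, A k l * c i j l) - (∑ l, A l i * c l j k) - (∑ l, A l j * c i l k)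

/-- The inner product on `Λ²𝔤*⊗𝔤` induced by `G` (full sum over ordered pairs). -/
noncomputable def tinner (G : Matrix (Fin n) (Fin n) ℝ) (μ ν : Fin n → Fin n → Fin n → ℝ) : ℝ :=
  ∑ i, ∑ j, ∑ p, ∑ q, G⁻¹ i p * G⁻¹ j q * gdot G (μ i j) (ν p q)

/-- The (Hilbert–Schmidt) inner product of endomorphisms induced by `G`. -/
noncomputable def einner (G : Matrix (Fin n) (Fin n) ℝ) (A B : Matrix (Fin n) (Fin n) ℝ) : ℝ :=
  ∑ i, ∑ j, G⁻¹ i j * gdot G (fun k => A k i) (fun k => B k j)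

/-- The inner product of bilinear forms induced by `G`. -/
noncomputable def binner (G : Matrix (Fin n) (Fin n) ℝ) (S T : Matrix (Fin n) (Fin n) ℝ) : ℝ :=
  ∑ i, ∑ j, ∑ p, ∑ q, G⁻¹ i p * G⁻¹ j q * S i j * T p q

/-- `|Ric_G|²`. -/
noncomputable def ric2 (c : Fin n → Fin n → Fin n → ℝ) (G : Matrix (Fin n) (Fin n) ℝ) : ℝ :=
  binner G (Ricm c G) (Ricm c G)

/-- The functional `W₊(G,τ) = τ R_G + τ² |Ric_G|²`. -/
noncomputable def Wplus (c : Fin n → Fin n → Fin n → ℝ) (G : Matrix (Fin n) (Fin n) ℝ) (τ : ℝ) : ℝ :=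
  τ * scalR c G + τ ^ 2 * ric2 c G

/-- Structure constants of the 3-dimensional Heisenberg Lie algebra: `[e₀,e₁] = e₂`, `e₂` central. -/
def heis : Fin 3 → Fin 3 → Fin 3 → ℝ := fun i j k =>
  if i = 0 ∧ j = 1 ∧ k = 2 then 1 else if i = 1 ∧ j = 0 ∧ k = 2 then -1 else 0

end RFN

namespace RFN

variable {n : ℕ}

/-- The action of a matrix on the first index of a tensor. -/
def op1 (A : Matrix (Fin n) (Fin n) ℝ) (ν : Fin n → Fin n → Fin n → ℝ) :
    Fin n → Fin n → Fin n → ℝ :=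
  fun i j k => ∑ p, A i p * ν p j k

/-- The action of a matrix on the second index of a tensor. -/
def op2 (A : Matrix (Fin n) (Fin n) ℝ) (ν : Fin n → Fin n → Fin n → ℝ) :
    Fin n → Fin n → Fin n → ℝ :=
  fun i j k => ∑ q, A j q * ν i q k

/-- The action of a matrix on the third index of a tensor. -/
def op3 (A : Matrix (Fin n) (Fin n) ℝ) (ν : Fin n → Fin n → Fin n → ℝ) :
    Fin n → Fin n → Fin n → ℝ :=
  fun i j k => ∑ l, A k l * ν i j l

/-- The full contraction of two tensors. -/
def pair (μ ν : Fin n → Fin n → Fin n → ℝ) : ℝ := ∑ i, ∑ j, ∑ k, μ i j k * ν i j k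

variable (A B : Matrix (Fin n) (Fin n) ℝ) (c μ ν : Fin n → Fin n → Fin n → ℝ)

lemma op1_mul : op1 (A * B) ν = op1 A (op1 B ν) := by
  ext i j k
  simp only [op1, Matrix.mul_apply, Finset.sum_mul, Finset.mul_sum]
  rw [Finset.sum_comm]
  simp only [mul_assoc]

lemma op2_mul : op2 (A * B) ν = op2 A (op2 B ν) := by
  ext i j k
  simp only [op2, Matrix.mul_apply, Finset.sum_mul, Finset.mul_sum]
  rw [Finset.sum_comm]
  simp only [mul_assoc]

lemma op3_mul : op3 (A * B) ν = op3 A (op3 B ν) := by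
  ext i j k
  simp only [op3, Matrix.mul_apply, Finset.sum_mul, Finset.mul_sum]
  rw [Finset.sum_comm]
  simp only [mul_assoc]

lemma op2_op1 : op2 A (op1 B ν) = op1 B (op2 A ν) := by
  ext i j k
  simp only [op1, op2, Finset.mul_sum]
  rw [Finset.sum_comm]
  simp only [mul_left_comm]

lemma op3_op1 : op3 A (op1 B ν) = op1 B (op3 A ν) := by
  ext i j k
  simp only [op1, op3, Finset.mul_sum]
  rw [Finset.sum_comm]
  simp only [mul_left_comm]

lemma op3_op2 : op3 A (op2 B ν) = op2 B (op3 A ν) := by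
  ext i j k
  simp only [op2, op3, Finset.mul_sum]
  rw [Finset.sum_comm]
  simp only [mul_left_comm]

lemma op1_neg : op1 (-A) ν = -op1 A ν := by
  ext i j k; simp [op1]

lemma op2_neg : op2 (-A) ν = -op2 A ν := by
  ext i j k; simp [op2]

lemma op1_neg_right : op1 A (-ν) = -op1 A ν := by
  ext i j k; simp [op1]

lemma op1_sub : op1 A (μ - ν) = op1 A μ - op1 A ν := by
  ext i j k; simp [op1, mul_sub]

lemma op2_sub : op2 A (μ - ν) = op2 A μ - op2 A ν := by
  ext i j k; simp [op2, mul_sub]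

lemma op3_sub : op3 A (μ - ν) = op3 A μ - op3 A ν := by
  ext i j k; simp [op3, mul_sub]

lemma pair_comm : pair μ ν = pair ν μ := by
  simp only [pair, mul_comm]

lemma pair_sub (μ ν ρ : Fin n → Fin n → Fin n → ℝ) :
    pair μ (ν - ρ) = pair μ ν - pair μ ρ := by
  simp [pair, mul_sub]

lemma sub_pair (μ ν ρ : Fin n → Fin n → Fin n → ℝ) :
    pair (μ - ν) ρ = pair μ ρ - pair ν ρ := by
  simp [pair, sub_mul]

lemma pair_neg : pair μ (-ν) = -pair μ ν := by
  simp [pair]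

lemma pair_op1_eq_sum : pair μ (op1 A ν) =
    ∑ a, ∑ b, A a b * ∑ j, ∑ k, μ a j k * ν b j k := by
  simp only [pair, op1, Finset.mul_sum]
  refine Finset.sum_congr rfl fun a _ => ?_
  rw [Finset.sum_comm_cycle]
  refine Finset.sum_congr rfl fun b _ => Finset.sum_congr rfl fun j _ =>
    Finset.sum_congr rfl fun k _ => ?_
  ring

lemma pair_op3_eq_sum : pair μ (op3 A ν) =
    ∑ a, ∑ b, A a b * ∑ i, ∑ j, μ i j a * ν i j b := by
  simp only [pair, op3, Finset.mul_sum]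
  rw [Finset.sum_comm_cycle]
  refine Finset.sum_congr rfl fun a _ => ?_
  rw [Finset.sum_comm_cycle]
  refine Finset.sum_congr rfl fun b _ => Finset.sum_congr rfl fun j _ =>
    Finset.sum_congr rfl fun k _ => ?_
  ring

lemma pair_op1 : pair μ (op1 A ν) = pair (op1 Aᵀ μ) ν := by
  rw [pair_comm (op1 Aᵀ μ), pair_op1_eq_sum, pair_op1_eq_sum, Finset.sum_comm]
  simp only [Matrix.transpose_apply, mul_comm]

lemma pair_op2 : pair μ (op2 A ν) = pair (op2 Aᵀ μ) ν := by
  simp only [pair, op2, Finset.mul_sum, Finset.sum_mul, Matrix.transpose_apply]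
  refine Finset.sum_congr rfl fun a _ => ?_
  rw [Finset.sum_comm_cycle]
  refine Finset.sum_congr rfl fun b _ => ?_
  rw [Finset.sum_comm]
  refine Finset.sum_congr rfl fun k _ => Finset.sum_congr rfl fun j _ => ?_
  ring

lemma pair_op3 : pair μ (op3 A ν) = pair (op3 Aᵀ μ) ν := by
  rw [pair_comm (op3 Aᵀ μ), pair_op3_eq_sum, pair_op3_eq_sum, Finset.sum_comm]
  simp only [Matrix.transpose_apply, mul_comm]

lemma deltaE_eq : deltaE c A = op3 A c - op1 Aᵀ c - op2 Aᵀ c := by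
  ext i j k
  simp [deltaE, op1, op2, op3]

lemma tinner_eq (G : Matrix (Fin n) (Fin n) ℝ) :
    tinner G μ ν = pair μ (op1 G⁻¹ (op2 G⁻¹ (op3 G ν))) := by
  simp only [tinner, gdot, pair, op1, op2, op3, Finset.mul_sum]
  refine Finset.sum_congr rfl fun i _ => Finset.sum_congr rfl fun j _ => ?_
  rw [Finset.sum_comm_cycle]
  refine Finset.sum_congr rfl fun k _ => Finset.sum_congr rfl fun p _ =>
    Finset.sum_congr rfl fun q _ => Finset.sum_congr rfl fun l _ => ?_
  ring

lemma sum_sum_mul_pair (F : Fin n → Fin n → Fin n → Fin n → Fin n → ℝ) :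
    ∑ a, ∑ b, A a b * pair (F a b) ν = pair (fun i j k => ∑ a, ∑ b, A a b * F a b i j k) ν := by
  simp only [pair, Finset.mul_sum, Finset.sum_mul]
  rw [Finset.sum_comm_cycle]
  refine Finset.sum_congr rfl fun i _ => ?_
  rw [Finset.sum_comm_cycle]
  refine Finset.sum_congr rfl fun j _ => ?_
  rw [Finset.sum_comm_cycle]
  simp only [mul_assoc]

variable {G : Matrix (Fin n) (Fin n) ℝ}

lemma isSymm_inv (hG : G.IsSymm) : (G⁻¹).IsSymm := by
  rw [Matrix.IsSymm, Matrix.transpose_nonsing_inv, hG.eq]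

lemma tinner_comm (hG : G.IsSymm) : tinner G μ ν = tinner G ν μ := by
  rw [tinner_eq, tinner_eq, pair_op1, pair_op2, pair_op3, pair_comm, (isSymm_inv hG).eq, hG.eq,
    op3_op2, op3_op1, op2_op1]

lemma sum_tinner_deltaE_single (G : Matrix (Fin n) (Fin n) ℝ) :
    ∑ a, ∑ b, A b a * tinner G (deltaE c (Matrix.single b a 1)) ν = tinner G (deltaE c A) ν := by
  have h (i j k : Fin n) :
      ∑ a, ∑ b, A b a * deltaE c (Matrix.single b a 1) i j k = deltaE c A i j k := by
    simp only [deltaE, Matrix.single_apply, mul_sub, Finset.sum_sub_distrib, Finset.mul_sum]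
    congr 1
    · congr 1
      · simp [ite_and]
      · rw [Finset.sum_comm]
        simp [ite_and]
    · rw [Finset.sum_comm]
      simp [ite_and]
  simp only [tinner_eq]
  rw [← funext fun i => funext fun j => funext fun k => h i j k]
  exact sum_sum_mul_pair Aᵀ _ fun a b => deltaE c (Matrix.single b a 1)

lemma isSymm_Ricm (hG : G.IsSymm) : (Ricm c G).IsSymm := by
  ext a b
  have hK (i j : Fin n) : G⁻¹ i j = G⁻¹ j i := (isSymm_inv hG).apply j i
  have hg (x y : Fin n → ℝ) : gdot G x y = gdot G y x := by
    rw [gdot, gdot, Finset.sum_comm]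
    refine Finset.sum_congr rfl fun i _ => Finset.sum_congr rfl fun j _ => ?_
    rw [hG.apply i j]
    ring
  simp only [Ricm, Matrix.transpose_apply, Matrix.of_apply]
  congr 2
  · rw [Finset.sum_comm]
    refine Finset.sum_congr rfl fun i _ => Finset.sum_congr rfl fun j _ => ?_
    rw [hK, hg]
  · rw [Finset.sum_comm_cycle]
    refine (Finset.sum_congr rfl fun p _ => Finset.sum_comm_cycle).trans ?_
    refine Finset.sum_congr rfl fun i _ => Finset.sum_congr rfl fun j _ =>
      Finset.sum_congr rfl fun p _ => Finset.sum_congr rfl fun q _ => ?_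
    rw [hK i p, hK j q]
    ring

lemma Ricm_apply (a b : Fin n) : Ricm c G a b =
    -(1/2) * (∑ i, ∑ k, c a i k * op2 G⁻¹ (op3 G c) b i k) +
    (1/4) * ∑ i, ∑ j, op3 Gᵀ c i j a * op1 G⁻¹ (op2 G⁻¹ (op3 Gᵀ c)) i j b := by
  simp only [Ricm, Matrix.of_apply, gdot, op1, op2, op3, Finset.mul_sum, Finset.sum_mul]
  congr 1
  · refine Finset.sum_congr rfl fun i _ => ?_
    rw [Finset.sum_comm]
    refine Finset.sum_congr rfl fun j _ => Finset.sum_congr rfl fun k _ =>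
      Finset.sum_congr rfl fun l _ => ?_
    ring
  · refine Finset.sum_congr rfl fun i _ => Finset.sum_congr rfl fun j _ =>
      Finset.sum_congr rfl fun p _ => Finset.sum_congr rfl fun q _ => ?_
    simp only [Matrix.transpose_apply]
    refine Finset.sum_congr rfl fun l _ => Finset.sum_congr rfl fun k _ => ?_
    ring

lemma sum_Rc_mul_eq (hG : G.IsSymm) :
    ∑ a, ∑ b, Rc c G a b * A b a = ∑ a, ∑ b, (G⁻¹ * Aᵀ) a b * Ricm c G a b := by
  simp only [Rc, Matrix.mul_apply, Finset.sum_mul, Matrix.transpose_apply]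
  rw [Finset.sum_comm_cycle]
  refine Finset.sum_congr rfl fun a _ => ?_
  rw [Finset.sum_comm]
  refine Finset.sum_congr rfl fun b _ => Finset.sum_congr rfl fun s _ => ?_
  rw [(isSymm_inv hG).apply a s]
  ring

lemma tinner_op1_eq_tinner_op2 (hc : ∀ i j k, c i j k = -c j i k) :
    tinner G (op2 A c) c = tinner G (op1 A c) c := by
  rw [tinner, tinner, Finset.sum_comm]
  refine Finset.sum_congr rfl fun i _ => Finset.sum_congr rfl fun j _ => ?_
  rw [Finset.sum_comm]
  refine Finset.sum_congr rfl fun p _ => Finset.sum_congr rfl fun q _ => ?_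
  have h1 : op2 A c j i = -op1 A c i j := by
    ext k
    simp only [op1, op2, Pi.neg_apply, ← Finset.sum_neg_distrib]
    exact Finset.sum_congr rfl fun l _ => by rw [hc j l k, mul_neg]
  have h2 : c q p = -c p q := funext (hc q p)
  rw [h1, h2]
  simp only [gdot, Pi.neg_apply, neg_mul, mul_neg, neg_neg]
  ring

/-- The Ricci endomorphism is the moment map of the action on brackets. -/
lemma sum_Rc_mul (hc : ∀ i j k, c i j k = -c j i k) (hG : G.IsSymm) (hdet : IsUnit G.det) :
    ∑ a, ∑ b, Rc c G a b * A b a = (1/4) * tinner G (deltaE c A) c := by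
  have h1 : pair c (op1 (G⁻¹ * Aᵀ) (op2 G⁻¹ (op3 G c))) = tinner G (op1 Aᵀ c) c := by
    rw [tinner_comm _ _ hG, tinner_eq, op1_mul, op3_op1, op2_op1]
  have h2 : pair (op3 Gᵀ c) (op3 (G⁻¹ * Aᵀ) (op1 G⁻¹ (op2 G⁻¹ (op3 Gᵀ c)))) =
      tinner G (op3 A c) c := by
    rw [← pair_op3, ← op3_mul, ← mul_assoc, Matrix.mul_nonsing_inv _ hdet, one_mul, pair_op3,
      Matrix.transpose_transpose, hG.eq, tinner_eq]
  rw [pair_op1_eq_sum] at h1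
  rw [pair_op3_eq_sum] at h2
  have h3 : tinner G (deltaE c A) c =
      tinner G (op3 A c) c - tinner G (op1 Aᵀ c) c - tinner G (op2 Aᵀ c) c := by
    simp only [deltaE_eq, tinner_eq, sub_pair]
  rw [sum_Rc_mul_eq _ _ hG, h3, tinner_op1_eq_tinner_op2 _ _ hc, ← h1, ← h2]
  simp only [Ricm_apply, mul_add, Finset.sum_add_distrib, mul_left_comm _ (-(1 / 2) : ℝ),
    mul_left_comm _ (1 / 4 : ℝ), ← Finset.mul_sum]
  ring

lemma ric2_eq (hG : G.IsSymm) : ric2 c G = ∑ a, ∑ b, Rc c G a b * Rc c G b a := by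
  simp only [ric2, binner, Rc, Matrix.mul_apply, Finset.sum_mul, Finset.mul_sum]
  rw [Finset.sum_comm_cycle]
  refine Finset.sum_congr rfl fun a _ => ?_
  rw [Finset.sum_comm]
  refine Finset.sum_congr rfl fun b _ => ?_
  rw [Finset.sum_comm]
  refine Finset.sum_congr rfl fun p _ => Finset.sum_congr rfl fun q _ => ?_
  rw [(isSymm_inv hG).apply a q, (isSymm_Ricm c hG).apply a p]
  ring

variable {H : Matrix (Fin n) (Fin n) ℝ} {t₀ : ℝ}

section Inverse

attribute [local instance] Matrix.linftyOpNormedRing Matrix.linftyOpNormedAlgebra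

lemma hasDerivAt_inv_apply {G : ℝ → Matrix (Fin n) (Fin n) ℝ} (hdet : IsUnit (G t₀).det)
    (hder : ∀ i j, HasDerivAt (fun u => G u i j) (H i j) t₀) (i j : Fin n) :
    HasDerivAt (fun u => (G u)⁻¹ i j) ((-((G t₀)⁻¹ * H * (G t₀)⁻¹)) i j) t₀ := by
  have hG : HasDerivAt G H t₀ := hasDerivAt_pi.2 fun i => hasDerivAt_pi.2 fun j => hder i j
  obtain ⟨U, hU⟩ := (Matrix.isUnit_iff_isUnit_det _).2 hdet
  have h := hasFDerivAt_ringInverse (𝕜 := ℝ) U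
  rw [hU] at h
  have h2 := h.comp_hasDerivAt t₀ hG
  have h3 := hasDerivAt_pi.1 (hasDerivAt_pi.1 h2 i) j
  have hUi : ((U⁻¹ : (Matrix (Fin n) (Fin n) ℝ)ˣ) : Matrix (Fin n) (Fin n) ℝ) = (G t₀)⁻¹ := by
    rw [← hU, Matrix.coe_units_inv]
  simpa [Function.comp_def, ← Matrix.nonsing_inv_eq_ringInverse, hUi] using h3

end Inverse

lemma hasDerivAt_tinner {G : ℝ → Matrix (Fin n) (Fin n) ℝ} (hdet : IsUnit (G t₀).det)
    (hG : (G t₀).IsSymm) (hH : H.IsSymm)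
    (hder : ∀ i j, HasDerivAt (fun u => G u i j) (H i j) t₀) :
    HasDerivAt (fun u => tinner (G u) μ ν) (tinner (G t₀) μ (deltaE ν ((G t₀)⁻¹ * H))) t₀ := by
  have hK := isSymm_inv hG
  have hinv := hasDerivAt_inv_apply hdet hder
  have hform : HasDerivAt (fun u => tinner (G u) μ ν)
      (pair μ (op1 (-((G t₀)⁻¹ * H * (G t₀)⁻¹)) (op2 (G t₀)⁻¹ (op3 (G t₀) ν))) +
        pair μ (op1 (G t₀)⁻¹ (op2 (-((G t₀)⁻¹ * H * (G t₀)⁻¹)) (op3 (G t₀) ν))) +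
        pair μ (op1 (G t₀)⁻¹ (op2 (G t₀)⁻¹ (op3 H ν)))) t₀ := by
    simp only [tinner_eq, pair, op1, op2, op3, ← Finset.sum_add_distrib]
    refine HasDerivAt.fun_sum fun i _ => HasDerivAt.fun_sum fun j _ =>
      HasDerivAt.fun_sum fun k _ => ?_
    simp only [← mul_add, ← Finset.sum_add_distrib]
    refine HasDerivAt.const_mul _ (HasDerivAt.fun_sum fun p _ => ?_)
    have h := (hinv i p).fun_mul (HasDerivAt.fun_sum (u := Finset.univ) fun q _ =>
      (hinv j q).fun_mul (HasDerivAt.fun_sum (u := Finset.univ) fun l _ =>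
        (hder k l).mul_const (ν p q l)))
    refine h.congr_deriv ?_
    simp only [Finset.sum_add_distrib, mul_add]
    ring
  refine hform.congr_deriv (Eq.symm ?_)
  have hP : (G t₀)⁻¹ * H * (G t₀)⁻¹ = (G t₀)⁻¹ * ((G t₀)⁻¹ * H)ᵀ := by
    rw [Matrix.transpose_mul, hK.eq, hH.eq, mul_assoc]
  have hGH : op3 H ν = op3 (G t₀) (op3 ((G t₀)⁻¹ * H) ν) := by
    rw [← op3_mul, ← mul_assoc, Matrix.mul_nonsing_inv _ hdet, one_mul]
  rw [hGH, op1_neg, op2_neg, hP, op1_mul, op2_mul]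
  simp only [tinner_eq, deltaE_eq, op3_sub, op2_sub, op1_sub, pair_sub, op3_op1, op3_op2,
    op2_op1, pair_neg, op1_neg_right]
  ring

end RFN

open RFN Matrix

theorem stmt18 {n : ℕ} (cs : Fin n → Fin n → Fin n → ℝ) (hcs : IsLieSC cs)
    (G : ℝ → Matrix (Fin n) (Fin n) ℝ) (hpd : ∀ t, (G t).PosDef) (hsym : ∀ t, (G t).IsSymm)
    (t₀ : ℝ) (H : Matrix (Fin n) (Fin n) ℝ)
    (hder : ∀ i j, HasDerivAt (fun u => G u i j) (H i j) t₀) :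
    HasDerivAt (fun u => ric2 cs (G u))
      ((1/2) * tinner (G t₀) (deltaE cs ((G t₀)⁻¹ * H)) (deltaE cs (Rc cs (G t₀)))) t₀ := by
  have hdet (t : ℝ) : IsUnit (G t).det := (hpd t).det_pos.ne'.isUnit
  have hH : H.IsSymm := by
    ext i j
    refine (hder j i).unique ?_
    simpa only [(hsym _).apply i j] using hder i j
  have hRc (a b : Fin n) : HasDerivAt (fun u => Rc cs (G u) a b)
      ((1/4) * tinner (G t₀) (deltaE cs (Matrix.single b a 1))
        (deltaE cs ((G t₀)⁻¹ * H))) t₀ := by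
    have h (u : ℝ) : Rc cs (G u) a b =
        (1/4) * tinner (G u) (deltaE cs (Matrix.single b a 1)) cs := by
      rw [← sum_Rc_mul _ _ hcs.1 (hsym u) (hdet u)]
      simp [Matrix.single_apply, ite_and]
    simp only [h]
    exact (hasDerivAt_tinner _ _ (hdet t₀) (hsym t₀) hH hder).const_mul _
  simp only [ric2_eq _ (hsym _)]
  refine (HasDerivAt.fun_sum (u := Finset.univ) fun a _ =>
    HasDerivAt.fun_sum (u := Finset.univ) fun b _ =>
      (hRc a b).fun_mul (hRc b a)).congr_deriv (Eq.symm ?_)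
  rw [tinner_comm _ _ (hsym t₀)]
  simp only [Finset.sum_add_distrib]
  rw [Finset.sum_comm (f := fun a b => Rc cs (G t₀) a b * _),
    ← sum_tinner_deltaE_single (Rc cs (G t₀)) cs, ← Finset.sum_add_distrib, Finset.mul_sum]
  refine Finset.sum_congr rfl fun a _ => ?_
  rw [← Finset.sum_add_distrib, Finset.mul_sum]
  refine Finset.sum_congr rfl fun b _ => ?_
  ring
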